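/- arXiv:1702.05715 — 8 statements merged into one kernel-verified Lean document; each statement's English description precedes it below -/
import Mathlib

section
/- For every κ > 0 and s > 0 there exists a constant C > 0, depending only on κ and s, such that for all real numbers α ∈ [1, 2], A, u, v with u ≤ −1 and A − v ≤ u (equivalently u + v ≥ A), one has ∫_{A−v}^{u} e^{−ακ(v+t)} (−t)^{−s} dt ≤ C e^{−ακA} (v − A)^{−s}. (Note that the hypotheses force every t in the domain of integration to satisfy t ≤ −1, and v − A ≥ −u ≥ 1.) -/
theorem one_add_rpow_le_mul_exp {κ s x : ℝ} (hκ : 0 < κ) (hs : 0 < s) (hx : 0 ≤ x) :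
    (1 + x) ^ s ≤ (1 + 2 * s / κ) ^ s * Real.exp (κ / 2 * x) := by
  have hbase : 1 + x ≤ (1 + 2 * s / κ) * Real.exp (κ * x / (2 * s)) := by
    have h₁ : 1 ≤ Real.exp (κ * x / (2 * s)) := Real.one_le_exp (by positivity)
    have h₂ : κ * x / (2 * s) ≤ Real.exp (κ * x / (2 * s)) := by
      linarith [Real.add_one_le_exp (κ * x / (2 * s))]
    have h₃ : x = 2 * s / κ * (κ * x / (2 * s)) := by field_simp
    have h₄ := mul_le_mul_of_nonneg_left h₂ (by positivity : 0 ≤ 2 * s / κ)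
    linarith
  calc (1 + x) ^ s ≤ ((1 + 2 * s / κ) * Real.exp (κ * x / (2 * s))) ^ s :=
        Real.rpow_le_rpow (by positivity) hbase hs.le
    _ = (1 + 2 * s / κ) ^ s * Real.exp (κ / 2 * x) := by
        rw [Real.mul_rpow (by positivity) (Real.exp_pos _).le, ← Real.exp_mul]
        congr 2
        field_simp

theorem rpow_neg_le_rpow_neg_add_mul {s x y : ℝ} (hs : 0 < s) (hx : 0 ≤ x) (hy : 1 ≤ y) :
    y ^ (-s) ≤ (x + y) ^ (-s) * (1 + x) ^ s := by
  have hy₀ : 0 < y := by linarith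
  have hxy : 0 < x + y := by linarith
  have h : (x + y) ^ s ≤ y ^ s * (1 + x) ^ s := by
    rw [← Real.mul_rpow hy₀.le (by positivity)]
    exact Real.rpow_le_rpow hxy.le (by nlinarith) hs.le
  rw [Real.rpow_neg hy₀.le, Real.rpow_neg hxy.le, inv_mul_eq_div,
    le_div_iff₀ (by positivity), inv_mul_le_iff₀ (by positivity)]
  exact h

theorem integral_exp_neg_mul_sub_le {c a b : ℝ} (hc : 0 < c) :
    ∫ t in a..b, Real.exp (-(c * (t - a))) ≤ 1 / c := by
  have hderiv (t : ℝ) :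
      HasDerivAt (fun t ↦ -(Real.exp (-(c * (t - a))) / c)) (Real.exp (-(c * (t - a)))) t := by
    have h := ((((hasDerivAt_id' t).sub_const a).const_mul c).fun_neg.exp.div_const c).fun_neg
    refine h.congr_deriv ?_
    field_simp
  rw [intervalIntegral.integral_eq_sub_of_hasDerivAt (fun t _ ↦ hderiv t)
    (Continuous.intervalIntegrable (by fun_prop) _ _)]
  have : 0 ≤ Real.exp (-(c * (b - a))) / c := by positivity
  simp only [sub_self, mul_zero, neg_zero, Real.exp_zero]
  linarith

/-- Lemma 8.7 of Luk–Oh: for every `κ > 0` and `s > 0` there is a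
constant `C > 0`, depending only on `κ` and `s`, such that for all `α ∈ [1,2]`, `A`, `u`, `v`
with `u ≤ -1` and `A - v ≤ u`,
`∫_{A-v}^{u} e^{-ακ(v+t)} (-t)^{-s} dt ≤ C e^{-ακA} (v-A)^{-s}`. -/
theorem weighted_blueshift_integral_bound (κ s : ℝ) (hκ : 0 < κ) (hs : 0 < s) :
    ∃ C > 0, ∀ α A u v : ℝ, 1 ≤ α → α ≤ 2 → u ≤ -1 → A - v ≤ u →
      (∫ t in (A - v)..u, Real.exp (-(α * κ * (v + t))) * (-t) ^ (-s))
        ≤ C * Real.exp (-(α * κ * A)) * (v - A) ^ (-s) := by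
  refine ⟨(1 + 2 * s / κ) ^ s * (1 / (κ / 2)), by positivity, ?_⟩
  intro α A u v hα _ hu hAu
  have hw : 0 < v - A := by linarith
  have hpoint : ∀ t ∈ Set.Icc (A - v) u,
      Real.exp (-(α * κ * (v + t))) * (-t) ^ (-s) ≤
        (Real.exp (-(α * κ * A)) * (v - A) ^ (-s) * (1 + 2 * s / κ) ^ s) *
          Real.exp (-(κ / 2 * (t - (A - v)))) := by
    rintro t ⟨hAt, htu⟩
    obtain ⟨x, rfl⟩ : ∃ x, t = x + (A - v) := ⟨t - (A - v), by ring⟩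
    have hx : 0 ≤ x := by linarith
    have hexp : Real.exp (-(α * κ * (v + (x + (A - v))))) ≤
        Real.exp (-(α * κ * A)) * Real.exp (-(κ * x)) := by
      rw [← Real.exp_add, Real.exp_le_exp]
      nlinarith [mul_nonneg (sub_nonneg.2 hα) (mul_nonneg hκ.le hx)]
    have hpow := rpow_neg_le_rpow_neg_add_mul (y := -(x + (A - v))) hs hx (by linarith)
    rw [show x + -(x + (A - v)) = v - A by ring] at hpow
    calc _ ≤ (Real.exp (-(α * κ * A)) * Real.exp (-(κ * x))) *
          ((v - A) ^ (-s) * ((1 + 2 * s / κ) ^ s * Real.exp (κ / 2 * x))) := by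
          refine mul_le_mul hexp (hpow.trans ?_)
            (Real.rpow_nonneg (by linarith) _) (by positivity)
          exact mul_le_mul_of_nonneg_left (one_add_rpow_le_mul_exp hκ hs hx) (by positivity)
      _ = _ := by
          rw [add_sub_cancel_right,
            show -(κ / 2 * x) = -(κ * x) + κ / 2 * x by ring, Real.exp_add]
          ring
  have hint : IntervalIntegrable
      (fun t ↦ Real.exp (-(α * κ * (v + t))) * (-t) ^ (-s)) MeasureTheory.volume (A - v) u := by
    refine ContinuousOn.intervalIntegrable ?_
    rw [Set.uIcc_of_le hAu]
    refine ContinuousOn.mul (by fun_prop) (continuousOn_neg.rpow_const fun t ht ↦ Or.inl ?_)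
    have := ht.2
    linarith
  calc _ ≤ ∫ t in (A - v)..u,
        (Real.exp (-(α * κ * A)) * (v - A) ^ (-s) * (1 + 2 * s / κ) ^ s) *
          Real.exp (-(κ / 2 * (t - (A - v)))) :=
        intervalIntegral.integral_mono_on hAu hint
          (Continuous.intervalIntegrable (by fun_prop) _ _) hpoint
    _ ≤ (Real.exp (-(α * κ * A)) * (v - A) ^ (-s) * (1 + 2 * s / κ) ^ s) * (1 / (κ / 2)) := by
        rw [intervalIntegral.integral_const_mul]
        exact mul_le_mul_of_nonneg_left (integral_exp_neg_mul_sub_le (by positivity))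
          (by positivity)
    _ = _ := by ring
end

section
/- Let κ > 0, s ≥ 0, C₀ > 0, D > 0, Δ > 0. Then there exists δ > 0, depending only on κ, s, C₀, D, Δ, such that the following holds. Let v ≥ 1 and U ≥ 0 satisfy U e^{2κv} ≤ δ, and let Ψ : ℝ² → ℝ be twice continuously differentiable on a neighborhood of the segment [0, U] × {v}. Assume: (i) |∂_v Ψ(0, v)| ≤ D v^{−s}; and for every U′ ∈ [0, U]: (ii) |Ψ(U′, v)| ≤ 2D v^{−s}; (iii) |∂_U Ψ(U′, v)| ≤ Δ e^{2κv} v^{−s}; (iv) |∂_U ∂_v Ψ(U′, v)| ≤ C₀ ( e^{2κv} (|∂_v Ψ(U′, v)| + |Ψ(U′, v)|) + U′ e^{2κv} |∂_U Ψ(U′, v)| + |∂_U Ψ(U′, v)| · |∂_v Ψ(U′, v)| ). Then |∂_v Ψ(U′, v)| ≤ 2D v^{−s} for every U′ ∈ [0, U]. -/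
/-- The partial derivative of `Ψ : ℝ × ℝ → ℝ` in the first (`U`) direction. -/
noncomputable def pdU (Ψ : ℝ × ℝ → ℝ) (p : ℝ × ℝ) : ℝ := fderiv ℝ Ψ p (1, 0)

/-- The partial derivative of `Ψ : ℝ × ℝ → ℝ` in the second (`v`) direction. -/
noncomputable def pdV (Ψ : ℝ × ℝ → ℝ) (p : ℝ × ℝ) : ℝ := fderiv ℝ Ψ p (0, 1)

/-- The mixed partial derivative `∂_U ∂_v Ψ` of `Ψ : ℝ × ℝ → ℝ`. -/
noncomputable def pdUV (Ψ : ℝ × ℝ → ℝ) (p : ℝ × ℝ) : ℝ :=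
  fderiv ℝ (fun q => fderiv ℝ Ψ q (0, 1)) p (1, 0)

/-- Grönwall's inequality with constant coefficients, in the regime where the exponential factor
`exp (K * x)` is so close to `1` that the initial bound is at most doubled. -/
theorem abs_le_two_mul_of_abs_deriv_le {f f' : ℝ → ℝ} {U A K B : ℝ} (hK : 0 < K) (hA : 0 ≤ A)
    (hB : 0 ≤ B)
    (hf : ∀ x ∈ Set.Icc (0 : ℝ) U, HasDerivAt f (f' x) x) (h0 : |f 0| ≤ A)
    (bound : ∀ x ∈ Set.Icc (0 : ℝ) U, |f' x| ≤ K * |f x| + K * B)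
    (hsmall : (A + B) * (Real.exp (K * U) - 1) ≤ A) :
    ∀ x ∈ Set.Icc (0 : ℝ) U, |f x| ≤ 2 * A := by
  intro x hx
  have hg := norm_le_gronwallBound_of_norm_deriv_right_le
    (fun y hy => (hf y hy).continuousAt.continuousWithinAt)
    (fun y hy => (hf y (Set.Ico_subset_Icc_self hy)).hasDerivWithinAt) h0
    (fun y hy => bound y (Set.Ico_subset_Icc_self hy)) x hx
  rw [gronwallBound_of_K_ne_0 hK.ne', sub_zero, mul_div_cancel_left₀ _ hK.ne',
    Real.norm_eq_abs] at hg
  have hexp : Real.exp (K * x) ≤ Real.exp (K * U) := by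
    have := hx.2
    gcongr
  have := mul_le_mul_of_nonneg_left hexp (add_nonneg hA hB)
  linarith

/-- Along a horizontal line, `∂_v Ψ` has derivative `∂_U ∂_v Ψ` at points around which `Ψ` is
twice continuously differentiable. -/
theorem hasDerivAt_pdV {Ψ : ℝ × ℝ → ℝ} {x v : ℝ} (h : ContDiffAt ℝ 2 Ψ (x, v)) :
    HasDerivAt (fun y => pdV Ψ (y, v)) (pdUV Ψ (x, v)) x := by
  have h1 : DifferentiableAt ℝ (fderiv ℝ Ψ) (x, v) :=
    (h.fderiv_right (m := 1) (by norm_num)).differentiableAt (by norm_num)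
  have h2 : DifferentiableAt ℝ (fun q => fderiv ℝ Ψ q (0, 1)) (x, v) :=
    h1.clm_apply (differentiableAt_const _)
  exact h2.hasFDerivAt.comp_hasDerivAt x ((hasDerivAt_id x).prodMk (hasDerivAt_const x v))

/-- abstract form of Proposition 8.2, 'RS.rvP', of Luk–Oh: the estimate
for `∂_v Ψ` in the red-shift region. -/
theorem redshift_dv_estimate (κ s C₀ D Δ : ℝ)
    (hκ : 0 < κ) (hs : 0 ≤ s) (hC₀ : 0 < C₀) (hD : 0 < D) (hΔ : 0 < Δ) :
    ∃ δ > 0,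
      ∀ (v U : ℝ), 1 ≤ v → 0 ≤ U → U * Real.exp (2 * κ * v) ≤ δ →
      ∀ (Ψ : ℝ × ℝ → ℝ) (N : Set (ℝ × ℝ)),
        IsOpen N → (Set.Icc (0:ℝ) U) ×ˢ ({v} : Set ℝ) ⊆ N → ContDiffOn ℝ 2 Ψ N →
        -- (i) data bound
        |pdV Ψ (0, v)| ≤ D * v ^ (-s) →
        -- (ii) bootstrap bound on Ψ
        (∀ U' ∈ Set.Icc (0:ℝ) U, |Ψ (U', v)| ≤ 2 * D * v ^ (-s)) →
        -- (iii) bootstrap bound on ∂_U Ψ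
        (∀ U' ∈ Set.Icc (0:ℝ) U, |pdU Ψ (U', v)| ≤ Δ * Real.exp (2 * κ * v) * v ^ (-s)) →
        -- (iv) schematic wave equation
        (∀ U' ∈ Set.Icc (0:ℝ) U,
          |pdUV Ψ (U', v)| ≤
            C₀ * (Real.exp (2 * κ * v) * (|pdV Ψ (U', v)| + |Ψ (U', v)|)
              + U' * Real.exp (2 * κ * v) * |pdU Ψ (U', v)|
              + |pdU Ψ (U', v)| * |pdV Ψ (U', v)|)) →
        -- conclusion
        ∀ U' ∈ Set.Icc (0:ℝ) U, |pdV Ψ (U', v)| ≤ 2 * D * v ^ (-s) := by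
  set η : ℝ := D / (3 * D + Δ) with hη
  have hη0 : 0 < η := by positivity
  have hlog : 0 < Real.log (1 + η) := Real.log_pos (by linarith)
  refine ⟨min 1 (Real.log (1 + η) / (C₀ * (1 + Δ))), by positivity, ?_⟩
  intro v U hv hU hδ Ψ N hN hsub hΨ h0 hΨb hUb hwave
  set E := Real.exp (2 * κ * v)
  set w := v ^ (-s)
  have hE : 0 < E := Real.exp_pos _
  have hw : 0 < w := Real.rpow_pos_of_pos (by linarith) _
  have hw1 : w ≤ 1 := Real.rpow_le_one_of_one_le_of_nonpos hv (by linarith)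
  have hUE : U * E ≤ 1 := hδ.trans (min_le_left _ _)
  have hUE' : C₀ * (1 + Δ) * E * U ≤ Real.log (1 + η) := by
    have := (le_div_iff₀ (by positivity)).1 (hδ.trans (min_le_right _ _))
    linarith
  have key := abs_le_two_mul_of_abs_deriv_le (f := fun x => pdV Ψ (x, v))
    (f' := fun x => pdUV Ψ (x, v)) (U := U) (A := D * w) (K := C₀ * (1 + Δ) * E)
    (B := (2 * D + Δ) * w) (by positivity) (by positivity) (by positivity)
    (fun x hx => hasDerivAt_pdV (hΨ.contDiffAt (hN.mem_nhds (hsub ⟨hx, rfl⟩)))) h0 ?_ ?_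
  · simpa only [mul_assoc] using key
  · intro x hx
    have hxE : x * E ≤ 1 := (mul_le_mul_of_nonneg_right hx.2 hE.le).trans hUE
    have hf := abs_nonneg (pdV Ψ (x, v))
    calc |pdUV Ψ (x, v)|
        ≤ C₀ * (E * (|pdV Ψ (x, v)| + |Ψ (x, v)|) + x * E * |pdU Ψ (x, v)|
            + |pdU Ψ (x, v)| * |pdV Ψ (x, v)|) := hwave x hx
      _ ≤ C₀ * (E * (|pdV Ψ (x, v)| + 2 * D * w) + 1 * (Δ * E * w)
            + Δ * E * 1 * |pdV Ψ (x, v)|) := by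
          have h2 := hUb x hx
          have h3 : |pdU Ψ (x, v)| ≤ Δ * E * 1 := h2.trans (by gcongr)
          have h4 := hΨb x hx
          gcongr
      _ ≤ C₀ * (1 + Δ) * E * |pdV Ψ (x, v)| + C₀ * (1 + Δ) * E * ((2 * D + Δ) * w) := by
          have : 0 ≤ C₀ * Δ * E * ((2 * D + Δ) * w) := by positivity
          linarith
  · have hexp : Real.exp (C₀ * (1 + Δ) * E * U) - 1 ≤ η := by
      have := Real.exp_le_exp.2 hUE'
      rw [Real.exp_log (by linarith)] at this
      linarith
    calc (D * w + (2 * D + Δ) * w) * (Real.exp (C₀ * (1 + Δ) * E * U) - 1)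
        ≤ (D * w + (2 * D + Δ) * w) * η := by gcongr
      _ = D * w := by
          rw [hη]
          field_simp
          ring
end

section
/- For every κ > 0 and s > 0 there exists a constant C > 0, depending only on κ and s, such that the following holds. Let A ∈ ℝ, B > 0, and let u ≤ −1 and v be reals with u + v ≥ A. Let Ψ : ℝ² → ℝ be continuously differentiable in its first variable on a neighborhood of the segment [A − v, u] × {v}. If |Ψ(A − v, v)| ≤ B (v − A)^{−s} and |∂_u Ψ(u′, v)| ≤ 2B (−u′)^{−s} for every u′ ∈ [A − v, u], then e^{−κ(v+u)} |Ψ(u, v)| ≤ C B e^{−κA} (−u)^{−s}. -/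
/-- abstract form of Proposition 8.8, 'BS.P', of Luk–Oh: the
degenerate-weighted pointwise estimate for `Ψ` in the blue-shift region. -/
theorem blueshift_pointwise_estimate (κ s : ℝ) (hκ : 0 < κ) (hs : 0 < s) :
    ∃ C > 0, ∀ (A B u v : ℝ) (Ψ : ℝ × ℝ → ℝ) (N : Set ℝ),
      0 < B → u ≤ -1 → A ≤ u + v →
      IsOpen N → Set.Icc (A - v) u ⊆ N →
      ContDiffOn ℝ 1 (fun t => Ψ (t, v)) N →
      |Ψ (A - v, v)| ≤ B * (v - A) ^ (-s) →
      (∀ u' ∈ Set.Icc (A - v) u,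
        |deriv (fun t => Ψ (t, v)) u'| ≤ 2 * B * (-u') ^ (-s)) →
      Real.exp (-(κ * (v + u))) * |Ψ (u, v)| ≤ C * B * Real.exp (-(κ * A)) * (-u) ^ (-s) := by
  refine ⟨1 + 2 / κ, by positivity, ?_⟩
  intro A B u v Ψ N hB hu hA hN hsub hΨ h0 hd
  have mono : ∀ t ≤ u, (-t) ^ (-s) ≤ (-u) ^ (-s) := fun t ht =>
    Real.rpow_le_rpow_of_nonpos (by linarith) (by linarith) (by linarith)
  have hau : A - v ≤ u := by linarith
  have hdiff : ∀ t ∈ Set.Icc (A - v) u, DifferentiableAt ℝ (fun t => Ψ (t, v)) t := fun t ht =>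
    (hΨ.differentiableOn one_ne_zero).differentiableAt (hN.mem_nhds (hsub ht))
  have hmv := (convex_Icc (A - v) u).norm_image_sub_le_of_norm_deriv_le hdiff
    (C := 2 * B * (-u) ^ (-s))
    (fun t ht => (hd t ht).trans
      (mul_le_mul_of_nonneg_left (mono t ht.2) (by positivity)))
    (Set.left_mem_Icc.2 hau) (Set.right_mem_Icc.2 hau)
  simp only [Real.norm_eq_abs] at hmv
  rw [abs_of_nonneg (sub_nonneg.2 hau)] at hmv
  have h0' : |Ψ (A - v, v)| ≤ B * (-u) ^ (-s) := by
    refine h0.trans (mul_le_mul_of_nonneg_left ?_ hB.le)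
    simpa using mono (A - v) hau
  have hpow : 0 ≤ (-u) ^ (-s) := Real.rpow_nonneg (by linarith) _
  set x := u - (A - v) with hx
  have hx0 : 0 ≤ x := sub_nonneg.2 hau
  have hf : |Ψ (u, v)| ≤ B * (-u) ^ (-s) * (1 + 2 * x) := by
    have := abs_sub_abs_le_abs_sub (Ψ (u, v)) (Ψ (A - v, v))
    linarith
  have hlin : 1 + 2 * x ≤ (1 + 2 / κ) * Real.exp (κ * x) := by
    have h2 : (1 + 2 / κ) * (κ * x + 1) = 1 + 2 * x + (κ * x + 2 / κ) := by
      field_simp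
      ring
    have h3 : 0 ≤ κ * x + 2 / κ := by positivity
    have h4 := mul_le_mul_of_nonneg_left (Real.add_one_le_exp (κ * x))
      (by positivity : 0 ≤ 1 + 2 / κ)
    linarith
  calc Real.exp (-(κ * (v + u))) * |Ψ (u, v)|
      ≤ Real.exp (-(κ * (v + u))) *
          (B * (-u) ^ (-s) * ((1 + 2 / κ) * Real.exp (κ * x))) := by
        gcongr
        exact hf.trans (mul_le_mul_of_nonneg_left hlin (by positivity))
    _ = (1 + 2 / κ) * B * (Real.exp (-(κ * (v + u))) * Real.exp (κ * x)) * (-u) ^ (-s) := by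
        ring
    _ = (1 + 2 / κ) * B * Real.exp (-(κ * A)) * (-u) ^ (-s) := by
        rw [← Real.exp_add, hx]
        ring_nf
end

section
/- Let κ > 0, s ≥ 0, and C₀, C₁, D, R > 0, let u ∈ ℝ and v₀ ≥ 1. Then there exists C > 0, depending only on κ, s, C₀, C₁, D, R, such that the following holds. Let λ, ω, r : [v₀, ∞) → ℝ and φ : [v₀, ∞) → ℝ with ω > 0, λ/ω differentiable and φ differentiable, satisfying for every v ≥ v₀: (i) (λ/ω)′(v) = − ( r(v)/ω(v) ) · φ′(v)²; (ii) 0 < r(v) ≤ R; (iii) r(v)/ω(v) ≤ C₁ e^{2κ(v+u)}; (iv) |φ′(v)| ≤ D v^{−s}; and assume |λ(v₀)/ω(v₀)| ≤ C₀. Then |λ(v)/ω(v)| ≤ C ( 1 + e^{2κ(v+u)} v^{−2s} ) for every v ≥ v₀. -/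
/-- The derivative of the weight `exp (2κ(t+u)) (t+a)^(-2s)`. -/
theorem hasDerivAt_exp_mul_add_rpow (κ s u a t : ℝ) (ht : 0 < t + a) :
    HasDerivAt (fun x : ℝ => Real.exp (2 * κ * (x + u)) * (x + a) ^ (-(2 * s)))
      (Real.exp (2 * κ * (t + u)) * (t + a) ^ (-(2 * s)) * (2 * κ - 2 * s / (t + a))) t := by
  have h1 : HasDerivAt (fun x : ℝ => Real.exp (2 * κ * (x + u)))
      (Real.exp (2 * κ * (t + u)) * (2 * κ * 1)) t :=
    (((hasDerivAt_id t).add_const u).const_mul (2 * κ)).exp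
  have h2 : HasDerivAt (fun x : ℝ => (x + a) ^ (-(2 * s)))
      (1 * (-(2 * s)) * (t + a) ^ (-(2 * s) - 1)) t :=
    ((hasDerivAt_id t).add_const a).rpow_const (Or.inl ht.ne')
  refine (h1.mul h2).congr_deriv ?_
  rw [Real.rpow_sub_one ht.ne']
  ring

/-- With the shift `2s/κ`, the derivative of the weight dominates `exp (2κ(t+u)) t^(-2s)`. -/
theorem exp_mul_rpow_le_weight_deriv {κ s t : ℝ} (u : ℝ) (hκ : 0 < κ) (hs : 0 ≤ s)
    (ht : 1 ≤ t) :
    Real.exp (2 * κ * (t + u)) * t ^ (-(2 * s)) ≤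
      (1 + 2 * s / κ) ^ (2 * s) / κ *
        (Real.exp (2 * κ * (t + u)) * (t + 2 * s / κ) ^ (-(2 * s)) *
          (2 * κ - 2 * s / (t + 2 * s / κ))) := by
  set a := 2 * s / κ with ha
  have ha0 : 0 ≤ a := by positivity
  have hta : 0 < t + a := by linarith
  have hsa : 2 * s = κ * a := by rw [ha]; field_simp
  have h1 : κ ≤ 2 * κ - 2 * s / (t + a) := by
    have : 2 * s / (t + a) ≤ κ := by
      rw [div_le_iff₀ hta, hsa]
      nlinarith
    linarith
  have h2 : t ^ (-(2 * s)) ≤ (1 + a) ^ (2 * s) * (t + a) ^ (-(2 * s)) := by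
    have h3 : ((1 + a) * t) ^ (-(2 * s)) ≤ (t + a) ^ (-(2 * s)) :=
      Real.rpow_le_rpow_of_nonpos hta (by nlinarith) (by linarith)
    rw [Real.mul_rpow (by linarith) (by linarith)] at h3
    calc t ^ (-(2 * s))
        = (1 + a) ^ (2 * s) * ((1 + a) ^ (-(2 * s)) * t ^ (-(2 * s))) := by
          rw [← mul_assoc, ← Real.rpow_add (by linarith), add_neg_cancel, Real.rpow_zero, one_mul]
      _ ≤ _ := by gcongr
  calc Real.exp (2 * κ * (t + u)) * t ^ (-(2 * s))
      ≤ Real.exp (2 * κ * (t + u)) * ((1 + a) ^ (2 * s) * (t + a) ^ (-(2 * s))) := by gcongr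
    _ = (1 + a) ^ (2 * s) / κ * (Real.exp (2 * κ * (t + u)) * (t + a) ^ (-(2 * s)) * κ) := by
        field_simp
    _ ≤ _ := by gcongr


/-- abstract form of Proposition 8.14, 'dvr.improved', of Luk–Oh:
the refined bound for `λ/Ω² = ∂_v r / Ω²` near the Cauchy horizon, obtained by
integrating the Raychaudhuri equation `(λ/ω)' = -(r/ω)(φ')²`. -/
theorem refined_dvr_bound (κ s C₀ C₁ D R : ℝ)
    (hκ : 0 < κ) (hs : 0 ≤ s) (hC₀ : 0 < C₀) (hC₁ : 0 < C₁) (hD : 0 < D) (hR : 0 < R) :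
    ∃ C > 0, ∀ (u v₀ : ℝ), 1 ≤ v₀ →
      ∀ (lam ω r φ : ℝ → ℝ),
        (∀ v, v₀ ≤ v → 0 < ω v) →
        -- (i) Raychaudhuri equation
        (∀ v, v₀ ≤ v →
          HasDerivAt (fun t => lam t / ω t) (-(r v / ω v) * (deriv φ v) ^ 2) v) →
        (∀ v, v₀ ≤ v → DifferentiableAt ℝ φ v) →
        -- (ii) bounds on r
        (∀ v, v₀ ≤ v → 0 < r v ∧ r v ≤ R) →
        -- (iii) bound on r/ω
        (∀ v, v₀ ≤ v → r v / ω v ≤ C₁ * Real.exp (2 * κ * (v + u))) →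
        -- (iv) decay of φ'
        (∀ v, v₀ ≤ v → |deriv φ v| ≤ D * v ^ (-s)) →
        -- initial bound
        |lam v₀ / ω v₀| ≤ C₀ →
        -- conclusion
        ∀ v, v₀ ≤ v →
          |lam v / ω v| ≤ C * (1 + Real.exp (2 * κ * (v + u)) * v ^ (-(2 * s))) := by
  set a := 2 * s / κ with ha
  have ha0 : 0 ≤ a := by positivity
  set K := (1 + a) ^ (2 * s) / κ with hK
  have hK0 : 0 ≤ K := by positivity
  set M := C₁ * D ^ 2 * K with hM
  have hM0 : 0 ≤ M := by positivity
  refine ⟨C₀ + M, by positivity, ?_⟩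
  intro u v₀ hv₀ lam ω r φ hω hode _ hr hrω hφ hinit v hv
  have key : ‖lam v / ω v‖ ≤
      C₀ + M * (Real.exp (2 * κ * (v + u)) * (v + a) ^ (-(2 * s))) := by
    refine image_norm_le_of_norm_deriv_right_le_deriv_boundary'
      (f := fun t => lam t / ω t) (a := v₀) (b := v)
      (B := fun t => C₀ + M * (Real.exp (2 * κ * (t + u)) * (t + a) ^ (-(2 * s))))
      (f' := fun t => -(r t / ω t) * (deriv φ t) ^ 2)
      (B' := fun t => M * (Real.exp (2 * κ * (t + u)) * (t + a) ^ (-(2 * s)) *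
        (2 * κ - 2 * s / (t + a))))
      (fun t ht => (hode t ht.1).continuousAt.continuousWithinAt)
      (fun t ht => (hode t ht.1).hasDerivWithinAt) ?_ ?_ ?_ ?_ ⟨hv, le_rfl⟩
    · have : 0 ≤ v₀ + a := by linarith
      have : 0 ≤ M * (Real.exp (2 * κ * (v₀ + u)) * (v₀ + a) ^ (-(2 * s))) := by positivity
      exact hinit.trans (by linarith)
    · intro t ht
      exact (((hasDerivAt_exp_mul_add_rpow κ s u a t (by linarith [ht.1])).const_mul M).const_add
        C₀).continuousAt.continuousWithinAt
    · intro t ht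
      exact (((hasDerivAt_exp_mul_add_rpow κ s u a t (by linarith [ht.1])).const_mul M).const_add
        C₀).hasDerivWithinAt
    · intro t ht
      have ht1 : 1 ≤ t := hv₀.trans ht.1
      have hq : 0 ≤ r t / ω t := (div_pos (hr t ht.1).1 (hω t ht.1)).le
      have hsq : (deriv φ t) ^ 2 ≤ D ^ 2 * t ^ (-(2 * s)) := by
        calc (deriv φ t) ^ 2 = |deriv φ t| ^ 2 := (sq_abs _).symm
          _ ≤ (D * t ^ (-s)) ^ 2 := by gcongr; exact hφ t ht.1
          _ = D ^ 2 * t ^ (-(2 * s)) := by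
            rw [mul_pow, ← Real.rpow_mul_natCast (by linarith)]
            congr 2
            push_cast
            ring
      calc ‖-(r t / ω t) * (deriv φ t) ^ 2‖ = r t / ω t * (deriv φ t) ^ 2 := by
            rw [neg_mul, norm_neg, Real.norm_of_nonneg (by positivity)]
        _ ≤ C₁ * Real.exp (2 * κ * (t + u)) * (D ^ 2 * t ^ (-(2 * s))) := by
            gcongr
            exact hrω t ht.1
        _ = C₁ * D ^ 2 * (Real.exp (2 * κ * (t + u)) * t ^ (-(2 * s))) := by ring
        _ ≤ C₁ * D ^ 2 * (K * (Real.exp (2 * κ * (t + u)) * (t + a) ^ (-(2 * s)) *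
              (2 * κ - 2 * s / (t + a)))) := by
            exact mul_le_mul_of_nonneg_left (exp_mul_rpow_le_weight_deriv u hκ hs ht1)
              (by positivity)
        _ = _ := by rw [hM]; ring
  have hv1 : 0 < v := by linarith
  have hmono : (v + a) ^ (-(2 * s)) ≤ v ^ (-(2 * s)) :=
    Real.rpow_le_rpow_of_nonpos hv1 (by linarith) (by linarith)
  have hW : 0 ≤ Real.exp (2 * κ * (v + u)) * v ^ (-(2 * s)) := by positivity
  calc |lam v / ω v| ≤ C₀ + M * (Real.exp (2 * κ * (v + u)) * (v + a) ^ (-(2 * s))) := key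
    _ ≤ C₀ + M * (Real.exp (2 * κ * (v + u)) * v ^ (-(2 * s))) := by gcongr
    _ ≤ _ := by nlinarith [mul_nonneg hC₀.le hW]
end

section
/- Let κ > 0, r₀ > 0, C > 0, u ∈ ℝ and v₀ ∈ ℝ. Let λ, ω, r : [v₀, ∞) → ℝ and φ : [v₀, ∞) → ℝ with ω > 0, λ/ω differentiable and φ differentiable, satisfying for every v ≥ v₀: (i) (λ/ω)′(v) = − ( r(v)/ω(v) ) · φ′(v)²; (ii) r(v) ≥ r₀; (iii) ω(v) ≤ C e^{−2κ(v+u)}; and assume λ(v₀)/ω(v₀) ≤ 0 and ∫_{v₀}^{∞} e^{2κt} φ′(t)² dt = ∞. Then λ(v)/ω(v) → −∞ as v → ∞. -/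
open Filter

/-- A function with nonpositive derivative on `[a, ∞)` which does not tend to `-∞` has an
integrable derivative. -/
theorem tendsto_atBot_or_integrableOn_deriv_of_nonpos {g g' : ℝ → ℝ} {a : ℝ}
    (hg : ∀ x, a ≤ x → HasDerivAt g (g' x) x) (hg' : ∀ x, a ≤ x → g' x ≤ 0) :
    Tendsto g atTop atBot ∨ MeasureTheory.IntegrableOn g' (Set.Ioi a) := by
  have hanti : AntitoneOn g (Set.Ici a) := by
    refine antitoneOn_of_hasDerivWithinAt_nonpos (convex_Ici a)
      (fun x hx => (hg x hx).continuousAt.continuousWithinAt)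
      (fun x hx => (hg x (interior_subset hx)).hasDerivWithinAt)
      (fun x hx => hg' x (interior_subset hx))
  have hmax : Antitone fun x => g (max x a) := fun x y hxy =>
    hanti (le_max_right x a) (le_max_right y a) (max_le_max_right a hxy)
  have heq : (fun x => g (max x a)) =ᶠ[atTop] g := by
    filter_upwards [eventually_ge_atTop a] with x hx
    rw [max_eq_left hx]
  rcases tendsto_atTop_of_antitone hmax with h | ⟨l, hl⟩
  · exact Or.inl (h.congr' heq)
  · exact Or.inr (MeasureTheory.integrableOn_Ioi_deriv_of_nonpos' (fun x hx => hg x hx)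
      (fun x hx => hg' x (le_of_lt hx)) (hl.congr' heq))

/-- content of the proof of (blow.up.interior.dvr) in Theorem 5.2 of
Luk–Oh: along an outgoing null ray approaching the Cauchy horizon, the Raychaudhuri
equation and the divergence of the weighted energy of the scalar field force
`λ/Ω² = ∂_v r / Ω² → -∞`. -/
theorem dvr_blowup (κ r₀ C u v₀ : ℝ) (hκ : 0 < κ) (hr₀ : 0 < r₀) (hC : 0 < C)
    (lam ω r φ : ℝ → ℝ)
    (hω : ∀ v, v₀ ≤ v → 0 < ω v)
    -- (i) Raychaudhuri equation
    (hray : ∀ v, v₀ ≤ v →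
      HasDerivAt (fun t => lam t / ω t) (-(r v / ω v) * (deriv φ v) ^ 2) v)
    (hφ : ∀ v, v₀ ≤ v → DifferentiableAt ℝ φ v)
    -- (ii) lower bound on r
    (hr : ∀ v, v₀ ≤ v → r₀ ≤ r v)
    -- (iii) upper bound on ω
    (hωb : ∀ v, v₀ ≤ v → ω v ≤ C * Real.exp (-(2 * κ * (v + u))))
    -- initial sign
    (h0 : lam v₀ / ω v₀ ≤ 0)
    -- divergence of the weighted energy
    (hdiv : ∫⁻ t in Set.Ioi v₀, ENNReal.ofReal (Real.exp (2 * κ * t) * (deriv φ t) ^ 2) = ⊤) :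
    Tendsto (fun v => lam v / ω v) atTop atBot := by
  have hnonpos : ∀ v, v₀ ≤ v → -(r v / ω v) * (deriv φ v) ^ 2 ≤ 0 := fun v hv => by
    have : 0 ≤ r v / ω v := div_nonneg (hr₀.le.trans (hr v hv)) (hω v hv).le
    nlinarith [mul_nonneg this (sq_nonneg (deriv φ v))]
  refine (tendsto_atBot_or_integrableOn_deriv_of_nonpos hray hnonpos).resolve_right fun hint => ?_
  have hfin := (hint.const_mul (-(C * Real.exp (-(2 * κ * u)) / r₀))).lintegral_lt_top
  refine (lt_of_le_of_lt (MeasureTheory.setLIntegral_mono' measurableSet_Ioi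
    fun t ht => ENNReal.ofReal_le_ofReal ?_) hfin).ne hdiv
  have ht : v₀ ≤ t := le_of_lt ht
  have hωt := hω t ht
  have hweight : Real.exp (2 * κ * t) * ω t ≤ C * Real.exp (-(2 * κ * u)) := by
    calc Real.exp (2 * κ * t) * ω t
        ≤ Real.exp (2 * κ * t) * (C * Real.exp (-(2 * κ * (t + u)))) := by
          gcongr
          exact hωb t ht
      _ = C * (Real.exp (2 * κ * t) * Real.exp (-(2 * κ * (t + u)))) := by ring
      _ = C * Real.exp (-(2 * κ * u)) := by
          rw [← Real.exp_add]
          ring_nf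
  have hexp : Real.exp (2 * κ * t) ≤ C * Real.exp (-(2 * κ * u)) / r₀ * (r t / ω t) := by
    rw [div_mul_div_comm, le_div_iff₀ (by positivity)]
    calc Real.exp (2 * κ * t) * (r₀ * ω t) = Real.exp (2 * κ * t) * ω t * r₀ := by ring
      _ ≤ C * Real.exp (-(2 * κ * u)) * r t := by
          gcongr
          exact hr t ht
  calc Real.exp (2 * κ * t) * (deriv φ t) ^ 2
      ≤ C * Real.exp (-(2 * κ * u)) / r₀ * (r t / ω t) * (deriv φ t) ^ 2 := by gcongr
    _ = _ := by ring
end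

section
/- Let e ∈ ℝ and 0 < r₀ ≤ R < |e|, let u₁ < u₂ and V₁ < 1 be reals, and let Q = [u₁, u₂] × [V₁, 1). Let r : ℝ² → ℝ and Ω : ℝ² → (0, ∞) be functions such that on a neighborhood of Q the partial derivative ∂_V r and the mixed derivative ∂_u (r ∂_V r) exist and are continuous, Ω² is continuous, and the equation ∂_u ( r ∂_V r )(u, V) = − ( Ω²(u, V) / 4 ) · ( 1 − e²/r(u, V)² ) holds, together with the bounds r₀ ≤ r(u, V) ≤ R on Q. Then for every V₂ ∈ [V₁, 1), ∫_{u₁}^{u₂} ∫_{V₁}^{V₂} Ω²(u, V) dV du ≤ 8R² / ( e²/R² − 1 ); in particular the spacetime volume ∫_{u₁}^{u₂} ∫_{V₁}^{1} Ω² dV du is finite. -/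
open MeasureTheory

theorem setIntegral_Icc_prod_Icc {f : ℝ × ℝ → ℝ} {a b c d : ℝ} (hab : a ≤ b) (hcd : c ≤ d)
    (hf : IntegrableOn f (Set.Icc a b ×ˢ Set.Icc c d)) :
    ∫ p in Set.Icc a b ×ˢ Set.Icc c d, f p = ∫ x in a..b, ∫ y in c..d, f (x, y) := by
  rw [Measure.volume_eq_prod] at hf ⊢
  simp only [setIntegral_prod f hf, integral_Icc_eq_integral_Ioc,
    intervalIntegral.integral_of_le hab, intervalIntegral.integral_of_le hcd]

/-- If `g = ∂_V r` and `G = ∂_u (r ∂_V r)`, the double integral of `G` over a rectangle is half the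
alternating sum of `r ^ 2` over the corners. -/
theorem integral_integral_deriv_mul_deriv {r g G : ℝ × ℝ → ℝ} {a b c d : ℝ}
    (hab : a ≤ b) (hcd : c ≤ d)
    (hr : ∀ p ∈ Set.Icc a b ×ˢ Set.Icc c d, HasDerivAt (fun t => r (p.1, t)) (g p) p.2)
    (hg : ContinuousOn g (Set.Icc a b ×ˢ Set.Icc c d))
    (hrg : ∀ p ∈ Set.Icc a b ×ˢ Set.Icc c d,
      HasDerivAt (fun t => r (t, p.2) * g (t, p.2)) (G p) p.1)
    (hG : ContinuousOn G (Set.Icc a b ×ˢ Set.Icc c d)) :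
    ∫ x in a..b, ∫ y in c..d, G (x, y) =
      (r (b, d) ^ 2 - r (b, c) ^ 2 - (r (a, d) ^ 2 - r (a, c) ^ 2)) / 2 := by
  have hGi : IntegrableOn G (Set.Icc a b ×ˢ Set.Icc c d) :=
    hG.integrableOn_compact (isCompact_Icc.prod isCompact_Icc)
  have hcont (x : ℝ) (hx : x ∈ Set.Icc a b) :
      IntervalIntegrable (fun y => r (x, y) * g (x, y)) volume c d := by
    apply ContinuousOn.intervalIntegrable
    rw [Set.uIcc_of_le hcd]
    refine ContinuousOn.mul (fun y hy => (hr (x, y) ⟨hx, hy⟩).continuousAt.continuousWithinAt) ?_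
    exact hg.comp (by fun_prop) fun y hy => ⟨hx, hy⟩
  have hline (x : ℝ) (hx : x ∈ Set.Icc a b) :
      ∫ y in c..d, r (x, y) * g (x, y) = (r (x, d) ^ 2 - r (x, c) ^ 2) / 2 := by
    rw [intervalIntegral.integral_eq_sub_of_hasDerivAt (f := fun y => r (x, y) ^ 2 / 2) _
      (hcont x hx)]
    · ring
    · intro y hy
      rw [Set.uIcc_of_le hcd] at hy
      refine (((hr (x, y) ⟨hx, hy⟩).fun_pow 2).div_const 2).congr_deriv ?_
      push_cast
      ring
  rw [intervalIntegral_intervalIntegral_swap (F := fun x y => G (x, y))]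
  · have hinner : ∀ y ∈ Set.uIcc c d, ∫ x in a..b, G (x, y) =
        r (b, y) * g (b, y) - r (a, y) * g (a, y) := by
      intro y hy
      rw [Set.uIcc_of_le hcd] at hy
      refine intervalIntegral.integral_eq_sub_of_hasDerivAt
        (f := fun x => r (x, y) * g (x, y)) (fun x hx => ?_) ?_
      · rw [Set.uIcc_of_le hab] at hx
        exact hrg (x, y) ⟨hx, hy⟩
      · apply ContinuousOn.intervalIntegrable
        rw [Set.uIcc_of_le hab]
        exact hG.comp (by fun_prop) fun x hx => ⟨hx, hy⟩
    have ha := Set.left_mem_Icc.2 hab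
    have hb := Set.right_mem_Icc.2 hab
    rw [intervalIntegral.integral_congr hinner,
      intervalIntegral.integral_sub (hcont b hb) (hcont a ha), hline b hb, hline a ha]
    ring
  · rw [Set.uIoc_of_le hab, Set.uIoc_of_le hcd]
    exact hGi.mono_set (Set.prod_mono Set.Ioc_subset_Icc_self Set.Ioc_subset_Icc_self)

/-- A function that is nonnegative and continuous on a rectangle `[a, b] × [c, d)` and whose
integrals over the rectangles `[a, b] × [c, y]` are bounded is integrable. -/
theorem integrableOn_Icc_prod_Ico_of_integral_bounded {f : ℝ × ℝ → ℝ} {a b c d C : ℝ}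
    (hf : ContinuousOn f (Set.Icc a b ×ˢ Set.Ico c d))
    (hf0 : ∀ p ∈ Set.Icc a b ×ˢ Set.Ico c d, 0 ≤ f p)
    (hC : ∀ y, c ≤ y → y < d → ∫ p in Set.Icc a b ×ˢ Set.Icc c y, f p ≤ C) :
    IntegrableOn f (Set.Icc a b ×ˢ Set.Ico c d) := by
  rcases le_or_gt d c with hdc | hcd
  · simp [Set.Ico_eq_empty_of_le hdc]
  obtain ⟨y, -, hy, hlim⟩ := exists_seq_strictMono_tendsto' hcd
  have hS : MeasurableSet (Set.Icc a b ×ˢ Set.Ico c d) := measurableSet_Icc.prod measurableSet_Ico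
  have hsub (n : ℕ) : Set.Icc a b ×ˢ Set.Icc c (y n) ⊆ Set.Icc a b ×ˢ Set.Ico c d :=
    Set.prod_mono_right (Set.Icc_subset_Ico_right (hy n).2)
  have hcover : AECover (volume.restrict (Set.Icc a b ×ˢ Set.Ico c d)) Filter.atTop
      fun n => Set.Icc a b ×ˢ Set.Icc c (y n) :=
    { ae_eventually_mem := by
        filter_upwards [ae_restrict_mem hS] with p hp
        filter_upwards [hlim.eventually_const_lt hp.2.2] with n hn
        exact ⟨hp.1, hp.2.1, hn.le⟩
      measurableSet := fun n => measurableSet_Icc.prod measurableSet_Icc }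
  refine hcover.integrable_of_integral_bounded_of_nonneg_ae C (fun n => ?_)
    ((ae_restrict_mem hS).mono hf0) (.of_forall fun n => ?_)
  · rw [IntegrableOn, Measure.restrict_restrict_of_subset (hsub n)]
    exact (hf.mono (hsub n)).integrableOn_compact (isCompact_Icc.prod isCompact_Icc)
  · rw [Measure.restrict_restrict_of_subset (hsub n)]
    exact hC (y n) (hy n).1.le (hy n).2

/-- Lemma 10.2, 'lem.nonpert-vol', of Luk–Oh: on a characteristic
rectangle near the Cauchy horizon on which `0 < r₀ ≤ r ≤ R < |e|`, the equation
`∂_u (r ∂_V r) = -(Ω²/4)(1 - e²/r²)` forces the spacetime volume `∬ Ω²` to be finite,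
with the quantitative bound `8R²/(e²/R² - 1)`. -/
theorem finite_spacetime_volume (e r₀ R u₁ u₂ V₁ : ℝ)
    (hr₀ : 0 < r₀) (hr₀R : r₀ ≤ R) (hR : R < |e|) (hu : u₁ < u₂) (hV : V₁ < 1)
    (r Ω rV G : ℝ × ℝ → ℝ) (N : Set (ℝ × ℝ)) (hN : IsOpen N)
    (hQN : Set.Icc u₁ u₂ ×ˢ Set.Ico V₁ 1 ⊆ N)
    (hΩpos : ∀ p ∈ N, 0 < Ω p)
    (hΩcont : ContinuousOn (fun p => (Ω p) ^ 2) N)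
    -- `rV = ∂_V r` exists and is continuous on `N`
    (hrV : ∀ p ∈ N, HasDerivAt (fun t => r (p.1, t)) (rV p) p.2)
    (hrVcont : ContinuousOn rV N)
    -- `G = ∂_u (r ∂_V r)` exists and is continuous on `N`
    (hG : ∀ p ∈ N, HasDerivAt (fun t => r (t, p.2) * rV (t, p.2)) (G p) p.1)
    (hGcont : ContinuousOn G N)
    -- the wave equation for `r`
    (heq : ∀ p ∈ N, G p = -((Ω p) ^ 2 / 4) * (1 - e ^ 2 / (r p) ^ 2))
    -- bounds on `r` on the rectangle
    (hrbd : ∀ p ∈ Set.Icc u₁ u₂ ×ˢ Set.Ico V₁ 1, r₀ ≤ r p ∧ r p ≤ R) :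
    (∀ V₂, V₁ ≤ V₂ → V₂ < 1 →
      (∫ u in u₁..u₂, ∫ V in V₁..V₂, (Ω (u, V)) ^ 2) ≤ 8 * R ^ 2 / (e ^ 2 / R ^ 2 - 1)) ∧
    IntegrableOn (fun p => (Ω p) ^ 2) (Set.Icc u₁ u₂ ×ˢ Set.Ico V₁ 1) := by
  have hRpos : 0 < R := hr₀.trans_le hr₀R
  have hc : 0 < e ^ 2 / R ^ 2 - 1 := by
    rw [sub_pos, one_lt_div (by positivity), ← sq_abs e]
    gcongr
  have hsub {V₂ : ℝ} (h : V₂ < 1) :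
      Set.Icc u₁ u₂ ×ˢ Set.Icc V₁ V₂ ⊆ Set.Icc u₁ u₂ ×ˢ Set.Ico V₁ 1 :=
    Set.prod_mono_right (Set.Icc_subset_Ico_right h)
  have hint {f : ℝ × ℝ → ℝ} (hf : ContinuousOn f N) {V₂ : ℝ} (h : V₂ < 1) :
      IntegrableOn f (Set.Icc u₁ u₂ ×ˢ Set.Icc V₁ V₂) :=
    (hf.mono ((hsub h).trans hQN)).integrableOn_compact (isCompact_Icc.prod isCompact_Icc)
  have hle : ∀ p ∈ Set.Icc u₁ u₂ ×ˢ Set.Ico V₁ 1,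
      Ω p ^ 2 * (e ^ 2 / R ^ 2 - 1) ≤ 4 * G p := by
    intro p hp
    obtain ⟨h₁, h₂⟩ := hrbd p hp
    have hrpos : 0 < r p := hr₀.trans_le h₁
    have hmono : e ^ 2 / R ^ 2 ≤ e ^ 2 / r p ^ 2 := by gcongr
    rw [heq p (hQN hp)]
    nlinarith [mul_le_mul_of_nonneg_left hmono (sq_nonneg (Ω p))]
  have hbound (V₂ : ℝ) (h₁ : V₁ ≤ V₂) (h₂ : V₂ < 1) :
      ∫ p in Set.Icc u₁ u₂ ×ˢ Set.Icc V₁ V₂, Ω p ^ 2 ≤ 8 * R ^ 2 / (e ^ 2 / R ^ 2 - 1) := by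
    have hN' := (hsub h₂).trans hQN
    have hmono : ∫ p in Set.Icc u₁ u₂ ×ˢ Set.Icc V₁ V₂, Ω p ^ 2 * (e ^ 2 / R ^ 2 - 1) ≤
        ∫ p in Set.Icc u₁ u₂ ×ˢ Set.Icc V₁ V₂, 4 * G p :=
      setIntegral_mono_on ((hint hΩcont h₂).mul_const _) ((hint hGcont h₂).const_mul _)
        (measurableSet_Icc.prod measurableSet_Icc) fun p hp => hle p (hsub h₂ hp)
    rw [integral_mul_const, integral_const_mul,
      setIntegral_Icc_prod_Icc hu.le h₁ (hint hGcont h₂),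
      integral_integral_deriv_mul_deriv hu.le h₁ (fun p hp => hrV p (hN' hp))
        (hrVcont.mono hN') (fun p hp => hG p (hN' hp)) (hGcont.mono hN')] at hmono
    have hsq {u V : ℝ} (hu : u ∈ Set.Icc u₁ u₂) (hV : V ∈ Set.Icc V₁ V₂) :
        r (u, V) ^ 2 ≤ R ^ 2 := by
      obtain ⟨h, h'⟩ := hrbd (u, V) (hsub h₂ ⟨hu, hV⟩)
      exact pow_le_pow_left₀ (hr₀.le.trans h) h' 2
    rw [le_div_iff₀ hc]
    linarith [hsq (Set.right_mem_Icc.2 hu.le) (Set.right_mem_Icc.2 h₁),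
      hsq (Set.left_mem_Icc.2 hu.le) (Set.left_mem_Icc.2 h₁),
      sq_nonneg (r (u₂, V₁)), sq_nonneg (r (u₁, V₂)), sq_nonneg R]
  refine ⟨fun V₂ h₁ h₂ => ?_, integrableOn_Icc_prod_Ico_of_integral_bounded
    (hΩcont.mono hQN) (fun p _ => sq_nonneg (Ω p)) hbound⟩
  rw [← setIntegral_Icc_prod_Icc (f := fun p => Ω p ^ 2) hu.le h₁ (hint hΩcont h₂)]
  exact hbound V₂ h₁ h₂
end

section
/- Let u₁ < u₂ and V₁ < V₂ be reals and Q = [u₁, u₂] × [V₁, V₂]. Let r : ℝ² → (0, ∞) and φ : ℝ² → ℝ be continuously differentiable on a neighborhood of Q, with continuous mixed derivatives satisfying on Q the equations ∂_u ( r ∂_V φ ) = − (∂_V r) (∂_u φ) and ∂_V ( r ∂_u φ ) = − (∂_u r) (∂_V φ). Assume the smallness condition ∫_{u₁}^{u₂} sup_{V ∈ [V₁, V₂]} | ∂_u r / r |(u, V) du + ∫_{V₁}^{V₂} sup_{u ∈ [u₁, u₂]} | ∂_V r / r |(u, V) dV ≤ 1/2. Then ∫_{u₁}^{u₂} sup_{V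 ∈ [V₁, V₂]} ( r |∂_u φ| )(u, V) du + ∫_{V₁}^{V₂} sup_{u ∈ [u₁, u₂]} ( r |∂_V φ| )(u, V) dV ≤ 2 ( ∫_{u₁}^{u₂} ( r |∂_u φ| )(u, V₁) du + ∫_{V₁}^{V₂} ( r |∂_V φ| )(u₁, V) dV ). -/
/-- On a closed rectangle, a function with both partial derivatives, the first of them continuous,
is jointly continuous. -/
lemma continuousOn_rectangle_of_partial {a b c d : ℝ} {f fx fy : ℝ × ℝ → ℝ}
    (hfx : ∀ p ∈ Set.Icc a b ×ˢ Set.Icc c d, HasDerivAt (fun t => f (t, p.2)) (fx p) p.1)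
    (hfy : ∀ p ∈ Set.Icc a b ×ˢ Set.Icc c d, HasDerivAt (fun t => f (p.1, t)) (fy p) p.2)
    (hfxc : ContinuousOn fx (Set.Icc a b ×ˢ Set.Icc c d)) :
    ContinuousOn f (Set.Icc a b ×ˢ Set.Icc c d) := by
  obtain ⟨C, hC⟩ := (isCompact_Icc.prod isCompact_Icc).exists_bound_of_continuousOn hfxc
  have hlip : ∀ y ∈ Set.Icc c d, LipschitzOnWith C.toNNReal (fun t => f (t, y)) (Set.Icc a b) := by
    intro y hy
    refine (convex_Icc a b).lipschitzOnWith_of_nnnorm_hasDerivWithin_le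
      (f' := fun t => fx (t, y)) (fun x hx => (hfx (x, y) ⟨hx, hy⟩).hasDerivWithinAt) ?_
    intro x hx
    rw [← NNReal.coe_le_coe, coe_nnnorm]
    exact (hC (x, y) ⟨hx, hy⟩).trans (Real.le_coe_toNNReal C)
  refine continuousOn_prod_of_continuousOn_lipschitzOnWith f C.toNNReal ?_ hlip
  intro x hx y hy
  exact (hfy (x, y) ⟨hx, hy⟩).continuousAt.continuousWithinAt

/-- The supremum over a set of a nonnegative function dominates each of its values there. -/
lemma le_biSup_of_nonneg {ι : Type*} {s : Set ι} {g : ι → ℝ} (hg : ∀ y ∈ s, 0 ≤ g y)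
    (hb : BddAbove (g '' s)) {y : ι} (hy : y ∈ s) : g y ≤ ⨆ z ∈ s, g z := by
  obtain ⟨C, hC⟩ := hb
  have hCg : ∀ z ∈ s, g z ≤ C := fun z hz => hC ⟨z, hz, rfl⟩
  refine le_ciSup_of_le (f := fun z => ⨆ _ : z ∈ s, g z) ⟨C, ?_⟩ y (by simp [hy])
  rintro _ ⟨z, rfl⟩
  exact Real.iSup_le (fun hz => hCg z hz) ((hg y hy).trans (hCg y hy))

/-- The supremum of a jointly continuous nonnegative function over one of its compact variables
depends continuously on the other one. -/
lemma continuousOn_biSup_Icc {a b c d : ℝ} (hab : a ≤ b) (hcd : c ≤ d) {g : ℝ → ℝ → ℝ}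
    (hg : ∀ x ∈ Set.Icc a b, ∀ y ∈ Set.Icc c d, 0 ≤ g x y)
    (hc : ContinuousOn (Function.uncurry g) (Set.Icc a b ×ˢ Set.Icc c d)) :
    ContinuousOn (fun x => ⨆ y ∈ Set.Icc c d, g x y) (Set.Icc a b) := by
  have hF : Continuous (Function.uncurry fun x y : ℝ =>
      g (Set.projIcc a b hab x) (Set.projIcc c d hcd y)) :=
    hc.comp_continuous
      (f := fun p : ℝ × ℝ =>
        ((Set.projIcc a b hab p.1 : ℝ), (Set.projIcc c d hcd p.2 : ℝ)))
      (by fun_prop) (fun p => ⟨Subtype.coe_prop _, Subtype.coe_prop _⟩)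
  refine ((isCompact_Icc (a := c) (b := d)).continuous_sSup
    (f := fun x y : ℝ => g (Set.projIcc a b hab x) (Set.projIcc c d hcd y)) hF).continuousOn.congr ?_
  intro x hx
  have himg : (fun y : ℝ => g (Set.projIcc a b hab x) (Set.projIcc c d hcd y)) '' Set.Icc c d
      = g x '' Set.Icc c d := by
    refine Set.image_congr fun y hy => ?_
    rw [Set.projIcc_of_mem hab hx, Set.projIcc_of_mem hcd hy]
  have hbdd : BddAbove (g x '' Set.Icc c d) := isCompact_Icc.bddAbove_image
    (hc.comp (f := fun y => (x, y)) (by fun_prop) fun y hy => ⟨hx, hy⟩)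
  have hne : (g x '' Set.Icc c d).Nonempty := (Set.nonempty_Icc.2 hcd).image _
  have h0 : 0 ≤ sSup (g x '' Set.Icc c d) :=
    Real.sSup_nonneg (by rintro _ ⟨y, hy, rfl⟩; exact hg x hx y hy)
  simp only [himg]
  refine le_antisymm (Real.iSup_le (fun y => Real.iSup_le (fun hy => ?_) h0) h0)
    (csSup_le hne ?_)
  · exact le_csSup hbdd ⟨y, hy, rfl⟩
  · rintro _ ⟨y, hy, rfl⟩
    exact le_biSup_of_nonneg (hg x hx) hbdd hy

/-- Integrating a transport equation `∂_y (r f) = -k g` over a rectangle bounds the `L¹L^∞` norm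
of `r f` by its initial value and the product of those of `k / r` and `r g`. -/
lemma integral_biSup_le_of_transport {a b c d : ℝ} (hab : a ≤ b) (hcd : c ≤ d)
    {r f g k : ℝ → ℝ → ℝ}
    (hr : ∀ x ∈ Set.Icc a b, ∀ y ∈ Set.Icc c d, 0 < r x y)
    (hrc : ContinuousOn (Function.uncurry r) (Set.Icc a b ×ˢ Set.Icc c d))
    (hfc : ContinuousOn (Function.uncurry f) (Set.Icc a b ×ˢ Set.Icc c d))
    (hgc : ContinuousOn (Function.uncurry g) (Set.Icc a b ×ˢ Set.Icc c d))
    (hkc : ContinuousOn (Function.uncurry k) (Set.Icc a b ×ˢ Set.Icc c d))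
    (hder : ∀ x ∈ Set.Icc a b, ∀ y ∈ Set.Icc c d,
      HasDerivAt (fun t => r x t * f x t) (-(k x y) * g x y) y) :
    (∫ x in a..b, ⨆ y ∈ Set.Icc c d, r x y * |f x y|)
      ≤ (∫ x in a..b, r x c * |f x c|)
        + (∫ x in a..b, ⨆ y ∈ Set.Icc c d, |k x y / r x y|)
          * (∫ y in c..d, ⨆ x ∈ Set.Icc a b, r x y * |g x y|) := by
  have hswap : ∀ {h : ℝ → ℝ → ℝ},
      ContinuousOn (Function.uncurry h) (Set.Icc a b ×ˢ Set.Icc c d) →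
      ContinuousOn (Function.uncurry fun y x => h x y) (Set.Icc c d ×ˢ Set.Icc a b) :=
    fun hh => hh.comp continuous_swap.continuousOn fun p hp => ⟨hp.2, hp.1⟩
  have hslice : ∀ {h : ℝ → ℝ → ℝ},
      ContinuousOn (Function.uncurry h) (Set.Icc a b ×ˢ Set.Icc c d) →
      ∀ x ∈ Set.Icc a b, ContinuousOn (h x) (Set.Icc c d) :=
    fun hh x hx => hh.comp (f := fun y => (x, y)) (by fun_prop) fun y hy => ⟨hx, hy⟩
  have hslice' : ∀ {h : ℝ → ℝ → ℝ},
      ContinuousOn (Function.uncurry h) (Set.Icc a b ×ˢ Set.Icc c d) →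
      ∀ y ∈ Set.Icc c d, ContinuousOn (fun x => h x y) (Set.Icc a b) :=
    fun hh y hy => hh.comp (f := fun x => (x, y)) (by fun_prop) fun x hx => ⟨hx, hy⟩
  have hrf : ContinuousOn (Function.uncurry fun x y => r x y * |f x y|)
      (Set.Icc a b ×ˢ Set.Icc c d) := hrc.mul hfc.abs
  have hrg : ContinuousOn (Function.uncurry fun x y => r x y * |g x y|)
      (Set.Icc a b ×ˢ Set.Icc c d) := hrc.mul hgc.abs
  have hkr : ContinuousOn (Function.uncurry fun x y => |k x y / r x y|)
      (Set.Icc a b ×ˢ Set.Icc c d) :=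
    (hkc.div hrc fun p hp => (hr p.1 hp.1 p.2 hp.2).ne').abs
  have hrf0 : ∀ x ∈ Set.Icc a b, ∀ y ∈ Set.Icc c d, 0 ≤ r x y * |f x y| :=
    fun x hx y hy => mul_nonneg (hr x hx y hy).le (abs_nonneg _)
  have hrg0 : ∀ y ∈ Set.Icc c d, ∀ x ∈ Set.Icc a b, 0 ≤ r x y * |g x y| :=
    fun y hy x hx => mul_nonneg (hr x hx y hy).le (abs_nonneg _)
  have hF := continuousOn_biSup_Icc hab hcd hrf0 hrf
  have hK := continuousOn_biSup_Icc hab hcd (fun _ _ _ _ => abs_nonneg _) hkr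
  have hG := continuousOn_biSup_Icc hcd hab hrg0 (hswap hrg)
  have hc : c ∈ Set.Icc c d := Set.left_mem_Icc.2 hcd
  have hinit : ContinuousOn (fun x => r x c * |f x c|) (Set.Icc a b) :=
    hslice' hrf c hc
  set K : ℝ → ℝ := fun x => ⨆ y ∈ Set.Icc c d, |k x y / r x y|
  set G : ℝ → ℝ := fun y => ⨆ x ∈ Set.Icc a b, r x y * |g x y|
  have hK0 : ∀ x, 0 ≤ K x := fun x =>
    Real.iSup_nonneg fun y => Real.iSup_nonneg fun _ => abs_nonneg _
  have hG0 : ∀ y ∈ Set.Icc c d, 0 ≤ G y := fun y hy =>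
    Real.iSup_nonneg fun x => Real.iSup_nonneg fun hx => hrg0 y hy x hx
  have hGint : IntervalIntegrable G MeasureTheory.volume c d := hG.intervalIntegrable_of_Icc hcd
  have hGI : 0 ≤ ∫ y in c..d, G y := intervalIntegral.integral_nonneg hcd hG0
  have hpt : ∀ x ∈ Set.Icc a b, ∀ y ∈ Set.Icc c d,
      r x y * |f x y| ≤ r x c * |f x c| + K x * ∫ y in c..d, G y := by
    intro x hx y hy
    have hsub : Set.Icc c y ⊆ Set.Icc c d := Set.Icc_subset_Icc_right hy.2
    have hprod : ContinuousOn (fun t => -(k x t) * g x t) (Set.Icc c d) :=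
      (hslice hkc x hx).neg.mul (hslice hgc x hx)
    have hftc := intervalIntegral.integral_eq_sub_of_hasDerivAt
      (f := fun t => r x t * f x t) (f' := fun t => -(k x t) * g x t) (a := c) (b := y)
      (fun t ht => hder x hx t (hsub (by rwa [Set.uIcc_of_le hy.1] at ht)))
      ((hprod.mono hsub).intervalIntegrable_of_Icc hy.1)
    have hbound : ∀ t ∈ Set.Icc c d, |-(k x t) * g x t| ≤ K x * G t := by
      intro t ht
      have hrt := hr x hx t ht
      have h1 : |k x t / r x t| ≤ K x :=
        le_biSup_of_nonneg (g := fun t => |k x t / r x t|) (fun _ _ => abs_nonneg _)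
          (isCompact_Icc.bddAbove_image (hslice hkr x hx)) ht
      have h2 : r x t * |g x t| ≤ G t :=
        le_biSup_of_nonneg (g := fun x => r x t * |g x t|) (hrg0 t ht)
          (isCompact_Icc.bddAbove_image (hslice' hrg t ht)) hx
      calc |-(k x t) * g x t| = |k x t / r x t| * (r x t * |g x t|) := by
            rw [abs_mul, abs_neg, abs_div, abs_of_pos hrt]
            field_simp
        _ ≤ K x * G t := mul_le_mul h1 h2 (hrg0 t ht x hx) (hK0 x)
    have hint : |∫ t in c..y, -(k x t) * g x t| ≤ K x * ∫ y in c..d, G y := by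
      calc |∫ t in c..y, -(k x t) * g x t|
          ≤ ∫ t in c..y, |-(k x t) * g x t| :=
            intervalIntegral.abs_integral_le_integral_abs hy.1
        _ ≤ ∫ t in c..y, K x * G t :=
            intervalIntegral.integral_mono_on hy.1
              ((hprod.mono hsub).abs.intervalIntegrable_of_Icc hy.1)
              (((hG.mono hsub).intervalIntegrable_of_Icc hy.1).const_mul _)
              fun t ht => hbound t (hsub ht)
        _ = K x * ∫ t in c..y, G t := intervalIntegral.integral_const_mul _ _
        _ ≤ K x * ∫ y in c..d, G y := by
            refine mul_le_mul_of_nonneg_left ?_ (hK0 x)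
            refine intervalIntegral.integral_mono_interval le_rfl hy.1 hy.2 ?_ hGint
            exact (MeasureTheory.ae_restrict_iff' measurableSet_Ioc).2
              (Filter.Eventually.of_forall fun t ht => hG0 t (Set.Ioc_subset_Icc_self ht))
    have habs : ∀ t ∈ Set.Icc c d, r x t * |f x t| = |r x t * f x t| := fun t ht => by
      rw [abs_mul, abs_of_pos (hr x hx t ht)]
    rw [habs y hy, habs c hc]
    have heq : r x y * f x y = r x c * f x c + ∫ t in c..y, -(k x t) * g x t := by
      rw [hftc]; ring
    rw [heq]
    exact (abs_add_le _ _).trans (by gcongr)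
  have hinitI := hinit.intervalIntegrable_of_Icc (μ := MeasureTheory.volume) hab
  have hKI := (hK.intervalIntegrable_of_Icc (μ := MeasureTheory.volume) hab).mul_const (∫ y in c..d, G y)
  calc (∫ x in a..b, ⨆ y ∈ Set.Icc c d, r x y * |f x y|)
      ≤ ∫ x in a..b, (r x c * |f x c| + K x * ∫ y in c..d, G y) := by
        refine intervalIntegral.integral_mono_on hab (hF.intervalIntegrable_of_Icc hab)
          (hinitI.add hKI) fun x hx => ?_
        have h0 : 0 ≤ r x c * |f x c| + K x * ∫ y in c..d, G y :=
          add_nonneg (hrf0 x hx c hc) (mul_nonneg (hK0 x) hGI)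
        exact Real.iSup_le (fun y => Real.iSup_le (fun hy => hpt x hx y hy) h0) h0
    _ = _ := by
        rw [intervalIntegral.integral_add hinitI hKI, intervalIntegral.integral_mul_const]

/-- the doubling estimate (phi.Li.bounds.goal), Step 2 of the proof of
Lemma 10.3, 'lem.nonpert-L1', of Luk–Oh: on a characteristic rectangle on which the
relative variation of `r` is at most `1/2` in `L¹`-of-sup norm, the `L¹L^∞` norms of
`r ∂_u φ` and `r ∂_V φ` are at most twice their initial values. -/
theorem L1_Linfty_doubling (u₁ u₂ V₁ V₂ : ℝ) (hu : u₁ < u₂) (hV : V₁ < V₂)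
    (r φ ru rV φu φV : ℝ × ℝ → ℝ) (N : Set (ℝ × ℝ)) (hN : IsOpen N)
    (hQN : Set.Icc u₁ u₂ ×ˢ Set.Icc V₁ V₂ ⊆ N)
    (hrpos : ∀ p ∈ N, 0 < r p)
    -- first derivatives exist and are continuous on `N`
    (hru : ∀ p ∈ N, HasDerivAt (fun t => r (t, p.2)) (ru p) p.1)
    (hrV : ∀ p ∈ N, HasDerivAt (fun t => r (p.1, t)) (rV p) p.2)
    (hφu : ∀ p ∈ N, HasDerivAt (fun t => φ (t, p.2)) (φu p) p.1)
    (hφV : ∀ p ∈ N, HasDerivAt (fun t => φ (p.1, t)) (φV p) p.2)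
    (hruc : ContinuousOn ru N) (hrVc : ContinuousOn rV N)
    (hφuc : ContinuousOn φu N) (hφVc : ContinuousOn φV N)
    -- the wave equations `∂_u (r ∂_V φ) = -(∂_V r)(∂_u φ)` and `∂_V (r ∂_u φ) = -(∂_u r)(∂_V φ)`
    (heq1 : ∀ p ∈ N, HasDerivAt (fun t => r (t, p.2) * φV (t, p.2)) (-(rV p) * φu p) p.1)
    (heq2 : ∀ p ∈ N, HasDerivAt (fun t => r (p.1, t) * φu (p.1, t)) (-(ru p) * φV p) p.2)
    -- smallness of the relative variation of `r`
    (hsmall :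
      (∫ u in u₁..u₂, ⨆ V ∈ Set.Icc V₁ V₂, |ru (u, V) / r (u, V)|)
        + (∫ V in V₁..V₂, ⨆ u ∈ Set.Icc u₁ u₂, |rV (u, V) / r (u, V)|) ≤ 1 / 2) :
    (∫ u in u₁..u₂, ⨆ V ∈ Set.Icc V₁ V₂, r (u, V) * |φu (u, V)|)
      + (∫ V in V₁..V₂, ⨆ u ∈ Set.Icc u₁ u₂, r (u, V) * |φV (u, V)|)
    ≤ 2 * ((∫ u in u₁..u₂, r (u, V₁) * |φu (u, V₁)|)
      + (∫ V in V₁..V₂, r (u₁, V) * |φV (u₁, V)|)) := by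
  have hrcQ : ContinuousOn r (Set.Icc u₁ u₂ ×ˢ Set.Icc V₁ V₂) :=
    continuousOn_rectangle_of_partial (fun p hp => hru p (hQN hp)) (fun p hp => hrV p (hQN hp))
      (hruc.mono hQN)
  have hswap : ∀ {h : ℝ × ℝ → ℝ}, ContinuousOn h (Set.Icc u₁ u₂ ×ˢ Set.Icc V₁ V₂) →
      ContinuousOn (Function.uncurry fun V u => h (u, V)) (Set.Icc V₁ V₂ ×ˢ Set.Icc u₁ u₂) :=
    fun hh => hh.comp continuous_swap.continuousOn fun p hp => ⟨hp.2, hp.1⟩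
  have hX := integral_biSup_le_of_transport hu.le hV.le
    (r := fun u V => r (u, V)) (f := fun u V => φu (u, V)) (g := fun u V => φV (u, V))
    (k := fun u V => ru (u, V)) (fun u hu V hV => hrpos _ (hQN ⟨hu, hV⟩)) hrcQ
    (hφuc.mono hQN) (hφVc.mono hQN) (hruc.mono hQN)
    (fun u hu V hV => heq2 (u, V) (hQN ⟨hu, hV⟩))
  have hY := integral_biSup_le_of_transport hV.le hu.le
    (r := fun V u => r (u, V)) (f := fun V u => φV (u, V)) (g := fun V u => φu (u, V))
    (k := fun V u => rV (u, V)) (fun V hV u hu => hrpos _ (hQN ⟨hu, hV⟩)) (hswap hrcQ)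
    (hswap (hφVc.mono hQN)) (hswap (hφuc.mono hQN)) (hswap (hrVc.mono hQN))
    (fun V hV u hu => heq1 (u, V) (hQN ⟨hu, hV⟩))
  have hX0 : 0 ≤ ∫ u in u₁..u₂, ⨆ V ∈ Set.Icc V₁ V₂, r (u, V) * |φu (u, V)| :=
    intervalIntegral.integral_nonneg hu.le fun u hu => Real.iSup_nonneg fun V =>
      Real.iSup_nonneg fun hV => mul_nonneg (hrpos _ (hQN ⟨hu, hV⟩)).le (abs_nonneg _)
  have hY0 : 0 ≤ ∫ V in V₁..V₂, ⨆ u ∈ Set.Icc u₁ u₂, r (u, V) * |φV (u, V)| :=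
    intervalIntegral.integral_nonneg hV.le fun V hV => Real.iSup_nonneg fun u =>
      Real.iSup_nonneg fun hu => mul_nonneg (hrpos _ (hQN ⟨hu, hV⟩)).le (abs_nonneg _)
  have hα0 : 0 ≤ ∫ u in u₁..u₂, ⨆ V ∈ Set.Icc V₁ V₂, |ru (u, V) / r (u, V)| :=
    intervalIntegral.integral_nonneg hu.le fun u _ => Real.iSup_nonneg fun V =>
      Real.iSup_nonneg fun _ => abs_nonneg _
  have hβ0 : 0 ≤ ∫ V in V₁..V₂, ⨆ u ∈ Set.Icc u₁ u₂, |rV (u, V) / r (u, V)| :=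
    intervalIntegral.integral_nonneg hV.le fun V _ => Real.iSup_nonneg fun u =>
      Real.iSup_nonneg fun _ => abs_nonneg _
  have hαY := mul_le_mul_of_nonneg_right ((le_add_of_nonneg_right hβ0).trans hsmall) hY0
  have hβX := mul_le_mul_of_nonneg_right ((le_add_of_nonneg_left hα0).trans hsmall) hX0
  linarith
end

section
/- Let e ∈ ℝ, 0 < r₀ ≤ R < |e|, C > 0, u₁ < u₂, V₁ < 1 and Q = [u₁, u₂] × [V₁, 1). Let r : ℝ² → (0, ∞), φ : ℝ² → ℝ and Ω : ℝ² → (0, ∞) be functions such that on a neighborhood of Q: ∂_V r, ∂_V φ, ∂_V(∂_V r/Ω²) and ∂_u(r ∂_V r) exist and are continuous, and the equations (i) ∂_u ( r ∂_V r ) = − (Ω²/4)(1 − e²/r²) and (ii) ∂_V ( ∂_V r / Ω² ) = − r (∂_V φ)² / Ω² hold; assume also the bounds r₀ ≤ r ≤ R and C^{−1} ≤ Ω² ≤ C on Q. If lim_{V → 1} ∂_V r(u₁, V) = −∞, then for every u ∈ [u₁, u₂]: lim_{V → 1} ∂_V r(u, V) = −∞ and ∫_{V₁}^{1} ( (∂_V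 φ)² / Ω² )(u, V) dV = ∞. -/
open Filter

/-- If `F` has derivative `-g * f` on `[a, b)` with `f ≥ 0`, `g ≤ R`, and `F → -∞` at `b`,
then `f` has infinite integral on `[a, b)`. -/
theorem lintegral_eq_top_of_tendsto_atBot {F f g : ℝ → ℝ} {a b R : ℝ} (hab : a < b) (hR : 0 < R)
    (hF : ∀ t ∈ Set.Ico a b, HasDerivAt F (-(g t * f t)) t)
    (hf : ContinuousOn f (Set.Ico a b)) (hg : ContinuousOn g (Set.Ico a b))
    (hf0 : ∀ t ∈ Set.Ico a b, 0 ≤ f t) (hgR : ∀ t ∈ Set.Ico a b, g t ≤ R)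
    (hlim : Tendsto F (nhdsWithin b (Set.Iio b)) atBot) :
    (∫⁻ t in Set.Ico a b, ENNReal.ofReal (f t)) = ⊤ := by
  have key : ∀ c ∈ Set.Ico a b, ENNReal.ofReal ((F a - F c) / R) ≤
      ∫⁻ t in Set.Ico a b, ENNReal.ofReal (f t) := by
    intro c hc
    have hsub : Set.Icc a c ⊆ Set.Ico a b := fun t ht => ⟨ht.1, ht.2.trans_lt hc.2⟩
    have hfi : IntervalIntegrable f MeasureTheory.volume a c :=
      (hf.mono hsub).intervalIntegrable_of_Icc hc.1
    have hgfi : IntervalIntegrable (fun t => g t * f t) MeasureTheory.volume a c :=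
      ((hg.mul hf).mono hsub).intervalIntegrable_of_Icc hc.1
    have hFTC := intervalIntegral.integral_eq_sub_of_hasDerivAt
      (fun t ht => hF t (hsub (Set.uIcc_of_le hc.1 ▸ ht))) hgfi.neg
    rw [intervalIntegral.integral_neg] at hFTC
    have hmono : (∫ t in a..c, g t * f t) ≤ ∫ t in a..c, R * f t :=
      intervalIntegral.integral_mono_on hc.1 hgfi (hfi.const_mul R) fun t ht =>
        mul_le_mul_of_nonneg_right (hgR t (hsub ht)) (hf0 t (hsub ht))
    rw [intervalIntegral.integral_const_mul] at hmono
    have hle : (F a - F c) / R ≤ ∫ t in a..c, f t := by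
      rw [div_le_iff₀ hR]
      linarith
    have hsub' : Set.Ioc a c ⊆ Set.Ico a b := fun t ht => hsub ⟨ht.1.le, ht.2⟩
    calc ENNReal.ofReal ((F a - F c) / R) ≤ ENNReal.ofReal (∫ t in a..c, f t) :=
          ENNReal.ofReal_le_ofReal hle
      _ = ∫⁻ t in Set.Ioc a c, ENNReal.ofReal (f t) := by
          rw [intervalIntegral.integral_of_le hc.1]
          refine MeasureTheory.ofReal_integral_eq_lintegral_ofReal hfi.1 ?_
          filter_upwards [MeasureTheory.ae_restrict_mem measurableSet_Ioc] with t ht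
          exact hf0 t (hsub' ht)
      _ ≤ _ := MeasureTheory.lintegral_mono_set hsub'
  refine ENNReal.eq_top_of_forall_nnreal_le fun x => ?_
  obtain ⟨c, hcF, hc⟩ := ((hlim.eventually_le_atBot (F a - x * R)).and
    (Ico_mem_nhdsLT hab)).exists
  refine le_trans ?_ (key c hc)
  rw [← ENNReal.ofReal_coe_nnreal]
  apply ENNReal.ofReal_le_ofReal
  rw [le_div_iff₀ hR]
  linarith

/-- If `f → -∞`, `0 < g ≤ R` and `g * h ≤ f` eventually, then `h → -∞`. -/
theorem tendsto_atBot_of_mul_le {α : Type*} {l : Filter α} {f g h : α → ℝ} {R : ℝ}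
    (hf : Tendsto f l atBot) (hg : ∀ᶠ x in l, 0 < g x ∧ g x ≤ R)
    (hgh : ∀ᶠ x in l, g x * h x ≤ f x) : Tendsto h l atBot := by
  refine tendsto_atBot.2 fun b => ?_
  filter_upwards [hf.eventually_le_atBot (-(R * |b|)), hg, hgh] with x hx hgx hghx
  have h1 : g x * |b| ≤ R * |b| := mul_le_mul_of_nonneg_right hgx.2 (abs_nonneg b)
  have h2 : g x * h x ≤ g x * (-|b|) := by linarith
  exact (le_of_mul_le_mul_left h2 hgx.1).trans (neg_abs_le b)

/-- Lemma 10.5, 'lem.nonpert-blowup', of Luk–Oh: near the Cauchy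
horizon `{V = 1}`, under uniform bounds on `r` and `Ω²`, the blow up of `∂_V r` on one
outgoing null ray propagates to all rays, and the Raychaudhuri equation forces the
divergence of the flux `∫ (∂_V φ)²/Ω² dV` on every ray. -/
theorem blowup_propagation (e r₀ R C u₁ u₂ V₁ : ℝ)
    (hr₀ : 0 < r₀) (hr₀R : r₀ ≤ R) (hR : R < |e|) (hC : 0 < C)
    (hu : u₁ < u₂) (hV : V₁ < 1)
    (r φ Ω rV φV : ℝ × ℝ → ℝ) (N : Set (ℝ × ℝ)) (hN : IsOpen N)
    (hQN : Set.Icc u₁ u₂ ×ˢ Set.Ico V₁ 1 ⊆ N)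
    (hΩpos : ∀ p ∈ N, 0 < Ω p)
    -- `rV = ∂_V r`, `φV = ∂_V φ` exist and are continuous on `N`
    (hrV : ∀ p ∈ N, HasDerivAt (fun t => r (p.1, t)) (rV p) p.2)
    (hφV : ∀ p ∈ N, HasDerivAt (fun t => φ (p.1, t)) (φV p) p.2)
    (hrVc : ContinuousOn rV N) (hφVc : ContinuousOn φV N)
    (hrc : ContinuousOn r N) (hΩc : ContinuousOn Ω N)
    -- (i) the wave equation `∂_u (r ∂_V r) = -(Ω²/4)(1 - e²/r²)`
    (heq : ∀ p ∈ N, HasDerivAt (fun t => r (t, p.2) * rV (t, p.2))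
      (-((Ω p) ^ 2 / 4) * (1 - e ^ 2 / (r p) ^ 2)) p.1)
    -- (ii) the Raychaudhuri equation `∂_V (∂_V r/Ω²) = -r (∂_V φ)²/Ω²`
    (hray : ∀ p ∈ N, HasDerivAt (fun t => rV (p.1, t) / (Ω (p.1, t)) ^ 2)
      (-(r p) * (φV p) ^ 2 / (Ω p) ^ 2) p.2)
    -- bounds on the rectangle
    (hrbd : ∀ p ∈ Set.Icc u₁ u₂ ×ˢ Set.Ico V₁ 1, r₀ ≤ r p ∧ r p ≤ R)
    (hΩbd : ∀ p ∈ Set.Icc u₁ u₂ ×ˢ Set.Ico V₁ 1, C⁻¹ ≤ (Ω p) ^ 2 ∧ (Ω p) ^ 2 ≤ C)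
    -- blow up on the initial ray `u = u₁`
    (hblow : Tendsto (fun V => rV (u₁, V)) (nhdsWithin 1 (Set.Iio 1)) atBot) :
    ∀ u ∈ Set.Icc u₁ u₂,
      Tendsto (fun V => rV (u, V)) (nhdsWithin 1 (Set.Iio 1)) atBot ∧
      (∫⁻ V in Set.Ico V₁ 1, ENNReal.ofReal ((φV (u, V)) ^ 2 / (Ω (u, V)) ^ 2)) = ⊤ := by
  intro u huI
  have hRpos : 0 < R := hr₀.trans_le hr₀R
  have hu₁ : u₁ ∈ Set.Icc u₁ u₂ := ⟨le_rfl, hu.le⟩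
  have hnear : ∀ᶠ V in nhdsWithin (1 : ℝ) (Set.Iio 1), V ∈ Set.Ico V₁ 1 := Ico_mem_nhdsLT hV
  have hderiv : ∀ p ∈ Set.Icc u₁ u₂ ×ˢ Set.Ico V₁ 1,
      ‖-((Ω p) ^ 2 / 4) * (1 - e ^ 2 / (r p) ^ 2)‖ ≤ C / 4 * (1 + e ^ 2 / r₀ ^ 2) := by
    intro p hp
    have h1 : |1 - e ^ 2 / (r p) ^ 2| ≤ 1 + e ^ 2 / r₀ ^ 2 := by
      have hle : e ^ 2 / (r p) ^ 2 ≤ e ^ 2 / r₀ ^ 2 := by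
        have := (hrbd p hp).1
        gcongr
      have hnn : 0 ≤ e ^ 2 / (r p) ^ 2 := by positivity
      rw [abs_le]
      constructor <;> linarith
    rw [norm_mul, norm_neg, Real.norm_eq_abs, Real.norm_eq_abs,
      abs_of_nonneg (by positivity : 0 ≤ (Ω p) ^ 2 / 4)]
    have := (hΩbd p hp).2
    gcongr
  have hprop : ∀ V ∈ Set.Ico V₁ 1, r (u, V) * rV (u, V) ≤
      r (u₁, V) * rV (u₁, V) + C / 4 * (1 + e ^ 2 / r₀ ^ 2) * ‖u - u₁‖ := by
    intro V hVI
    have h := (convex_Icc u₁ u₂).norm_image_sub_le_of_norm_hasDerivWithin_le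
      (f := fun t => r (t, V) * rV (t, V))
      (fun t ht => (heq (t, V) (hQN ⟨ht, hVI⟩)).hasDerivWithinAt)
      (fun t ht => hderiv (t, V) ⟨ht, hVI⟩) hu₁ huI
    have := (Real.le_norm_self _).trans h
    linarith
  have hinit : Tendsto (fun V => r (u₁, V) * rV (u₁, V)) (nhdsWithin 1 (Set.Iio 1)) atBot := by
    refine tendsto_atBot_mono' _ ?_ (hblow.const_mul_atBot hr₀)
    filter_upwards [hnear, hblow.eventually_le_atBot 0] with V hVI hneg
    exact mul_le_mul_of_nonpos_right (hrbd (u₁, V) ⟨hu₁, hVI⟩).1 hneg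
  have hlim : Tendsto (fun V => rV (u, V)) (nhdsWithin 1 (Set.Iio 1)) atBot := by
    refine tendsto_atBot_of_mul_le (g := fun V => r (u, V)) (R := R)
      (tendsto_atBot_add_const_right _ (C / 4 * (1 + e ^ 2 / r₀ ^ 2) * ‖u - u₁‖) hinit) ?_ ?_
    · filter_upwards [hnear] with V hVI
      have := hrbd (u, V) ⟨huI, hVI⟩
      exact ⟨hr₀.trans_le this.1, this.2⟩
    · filter_upwards [hnear] with V hVI using hprop V hVI
  refine ⟨hlim, ?_⟩
  have hmem : ∀ V ∈ Set.Ico V₁ 1, (u, V) ∈ N := fun V hVI => hQN ⟨huI, hVI⟩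
  have hray_cont : ∀ {f : ℝ × ℝ → ℝ}, ContinuousOn f N →
      ContinuousOn (fun V => f (u, V)) (Set.Ico V₁ 1) := fun hf =>
    hf.comp (by fun_prop) hmem
  refine lintegral_eq_top_of_tendsto_atBot (F := fun V => rV (u, V) / (Ω (u, V)) ^ 2)
    (g := fun V => r (u, V)) hV hRpos (fun V hVI => ?_) ?_ (hray_cont hrc)
    (fun V _ => by positivity) (fun V hVI => (hrbd (u, V) ⟨huI, hVI⟩).2) ?_
  · convert hray (u, V) (hmem V hVI) using 1
    ring
  · exact ((hray_cont hφVc).pow 2).div ((hray_cont hΩc).pow 2)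
      fun V hVI => pow_ne_zero 2 (hΩpos _ (hmem V hVI)).ne'
  · refine tendsto_atBot_of_mul_le (g := fun V => (Ω (u, V)) ^ 2) (R := C) hlim ?_ ?_
    · filter_upwards [hnear] with V hVI
      exact ⟨pow_pos (hΩpos _ (hmem V hVI)) 2, (hΩbd (u, V) ⟨huI, hVI⟩).2⟩
    · filter_upwards [hnear] with V hVI
      exact (mul_div_cancel₀ _ (pow_ne_zero 2 (hΩpos _ (hmem V hVI)).ne')).le
end
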